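/- (Classical cumulants of a product.) Let k ≥ 1 and, for each i ∈ {1,…,k}, let (R^{(i)}_m)_{m≥1} be a sequence of real numbers. For n ≥ 1 define M^{(i)}_n = Σ_{π ∈ P(n)} R^{(i)}_π, the sum over all set partitions of {1,…,n}. Then for every n ≥ 1, ∏_{i=1}^k M^{(i)}_n = Σ_{π ∈ P(n)} Q_π, where Q_m = Σ ∏_{i=1}^k R^{(i)}_{π_i}, the sum being over all k-tuples (π_1,…,π_k) of set partitions of {1,…,m} whose join in the partition lattice equals the one-block partition 1_m. -/

import Mathlib

open Finset
open scoped Classical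

/-- The join of a family of set partitions of `{1,…,n}` (modeled as finpartitions of
`Fin n`) in the partition lattice equals the one-block partition `1_n` iff every
partition coarser than all members of the family is `1_n` (whose set of blocks is
`{univ}`). -/
def PartitionJoinEqOne {n : ℕ} {ι : Type*} (π : ι → Finpartition (univ : Finset (Fin n))) :
    Prop :=
  ∀ σ : Finpartition (univ : Finset (Fin n)),
    (∀ i, π i ≤ σ) → σ.parts = {(univ : Finset (Fin n))}

namespace Finpartition

section Lattice

variable {α : Type*} [DecidableEq α] {s : Finset α}

lemma mem_restrict_parts_of_le {P σ : Finpartition s} (h : P ≤ σ) {S : Finset α}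
    (hS : S ∈ σ.parts) {b : Finset α} :
    b ∈ (P.restrict (σ.le hS)).parts ↔ b ∈ P.parts ∧ b ≤ S := by
  simp only [restrict, mem_erase, mem_image]
  constructor
  · rintro ⟨hb, p, hp, rfl⟩
    obtain ⟨T, hT, hpT⟩ := h hp
    have hST : S = T := by
      by_contra hne
      exact hb (eq_bot_iff.2 (((σ.disjoint hS hT hne).symm.mono_left hpT).le_bot))
    subst hST
    rw [inf_eq_left.2 hpT]
    exact ⟨hp, hpT⟩
  · rintro ⟨hb, hbS⟩
    exact ⟨P.ne_bot hb, b, hb, inf_eq_left.2 hbS⟩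

lemma restrict_mono {P P' : Finpartition s} (h : P ≤ P') {t : Finset α} (ht : t ≤ s) :
    P.restrict ht ≤ P'.restrict ht := by
  intro b hb
  simp only [restrict, mem_erase, mem_image] at hb
  obtain ⟨hb, p, hp, rfl⟩ := hb
  obtain ⟨q, hq, hpq⟩ := h hp
  have hle : p ⊓ t ≤ q ⊓ t := inf_le_inf_right t hpq
  refine ⟨q ⊓ t, ?_, hle⟩
  simp only [restrict, mem_erase, mem_image]
  exact ⟨ne_bot_of_le_ne_bot hb hle, q, hq, rfl⟩

lemma bind_le (σ : Finpartition s) (Q : ∀ S ∈ σ.parts, Finpartition S) : σ.bind Q ≤ σ := by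
  intro b hb
  obtain ⟨S, hS, hb⟩ := mem_bind.1 hb
  exact ⟨S, hS, (Q S hS).le hb⟩

lemma bind_restrict {P σ : Finpartition s} (h : P ≤ σ) :
    σ.bind (fun _ hS => P.restrict (σ.le hS)) = P := by
  ext b
  rw [mem_bind]
  constructor
  · rintro ⟨S, hS, hb⟩
    exact ((mem_restrict_parts_of_le h hS).1 hb).1
  · intro hb
    obtain ⟨S, hS, hbS⟩ := h hb
    exact ⟨S, hS, (mem_restrict_parts_of_le h hS).2 ⟨hb, hbS⟩⟩

lemma mem_of_mem_bind_of_le {σ : Finpartition s} {Q : ∀ S ∈ σ.parts, Finpartition S}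
    {S b c : Finset α} (hS : S ∈ σ.parts) (hb : b ∈ (σ.bind Q).parts) (hc : c ≠ ⊥) (hcb : c ≤ b)
    (hcS : c ≤ S) : b ∈ (Q S hS).parts := by
  obtain ⟨T, hT, hb⟩ := mem_bind.1 hb
  have hST : S = T := by
    by_contra hne
    exact hc (eq_bot_iff.2 ((σ.disjoint hS hT hne) hcS (hcb.trans ((Q T hT).le hb))))
  subst hST
  exact hb

lemma restrict_bind (σ : Finpartition s) (Q : ∀ S ∈ σ.parts, Finpartition S) {S : Finset α}
    (hS : S ∈ σ.parts) : (σ.bind Q).restrict (σ.le hS) = Q S hS := by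
  ext b
  rw [mem_restrict_parts_of_le (bind_le σ Q) hS]
  constructor
  · rintro ⟨hb, hbS⟩
    exact mem_of_mem_bind_of_le hS hb ((σ.bind Q).ne_bot hb) le_rfl hbS
  · intro hb
    exact ⟨mem_bind.2 ⟨S, hS, hb⟩, (Q S hS).le hb⟩

lemma prod_bind {M : Type*} [CommMonoid M] (σ : Finpartition s)
    (Q : ∀ S ∈ σ.parts, Finpartition S) (f : Finset α → M) :
    ∏ p ∈ (σ.bind Q).parts, f p = ∏ S : σ.parts, ∏ p ∈ (Q S.1 S.2).parts, f p := by
  rw [bind_parts, prod_biUnion]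
  · rfl
  rintro ⟨S, hS⟩ - ⟨T, hT⟩ - hne
  rw [Function.onFun, Finset.disjoint_left]
  intro b hbS hbT
  exact (Q S hS).ne_bot hbS (eq_bot_iff.2 (σ.disjoint hS hT (fun h => hne (Subtype.ext h))
    ((Q S hS).le hbS) ((Q T hT).le hbT)))

lemma isTop_iff_parts_eq (hs : s.Nonempty) (P : Finpartition s) : IsTop P ↔ P.parts = {s} := by
  constructor
  · intro h
    have h' : indiscrete hs.ne_empty = P :=
      le_antisymm (h _) fun b hb => ⟨s, mem_singleton_self s, P.le hb⟩
    rw [← h']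
    rfl
  · intro h Q b hb
    exact ⟨s, by simp [h], Q.le hb⟩

lemma exists_isLUB (A : Set (Finpartition s)) : ∃ σ, IsLUB A σ := by
  refine ⟨((univ : Finset (Finpartition s)).filter (· ∈ upperBounds A)).inf id, ?_⟩
  rw [← isGLB_upperBounds]
  simpa using Finset.isGLB_inf_id (s := (univ : Finset (Finpartition s)).filter (· ∈ upperBounds A))

/-- Every upper bound of the family `π` is the coarsest partition. -/
def JoinIsTop {ι : Type*} (π : ι → Finpartition s) : Prop :=
  ∀ σ, (∀ i, π i ≤ σ) → IsTop σ

lemma isLUB_iff_joinIsTop_restrict {ι : Type*} {π : ι → Finpartition s} {σ : Finpartition s}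
    (h : ∀ i, π i ≤ σ) :
    IsLUB (Set.range π) σ ↔
      ∀ S (hS : S ∈ σ.parts), JoinIsTop fun i => (π i).restrict (σ.le hS) := by
  constructor
  · intro hlub S hS τ hτ
    rw [isTop_iff_parts_eq (σ.nonempty_of_mem_parts hS)]
    set Q : ∀ T ∈ σ.parts, Finpartition T := fun T hT =>
      if hTS : S = T then τ.copy hTS else indiscrete (σ.ne_bot hT) with hQ
    have hQS : Q S hS = τ := by
      ext
      simp [hQ]
    have hle : σ ≤ σ.bind Q := by
      refine hlub.2 ?_
      rintro _ ⟨i, rfl⟩ b hb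
      obtain ⟨T, hT, hbT⟩ := h i hb
      by_cases hTS : S = T
      · subst hTS
        obtain ⟨c, hc, hbc⟩ := hτ i ((mem_restrict_parts_of_le (h i) hS).2 ⟨hb, hbT⟩)
        exact ⟨c, mem_bind.2 ⟨S, hS, by rwa [hQS]⟩, hbc⟩
      · refine ⟨T, mem_bind.2 ⟨T, hT, ?_⟩, hbT⟩
        simp [hQ, hTS]
    obtain ⟨c, hc, hSc⟩ := hle hS
    have hcτ := mem_of_mem_bind_of_le hS hc (σ.ne_bot hS) hSc le_rfl
    rw [hQS] at hcτ
    obtain rfl : c = S := le_antisymm (τ.le hcτ) hSc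
    refine (isTop_iff_parts_eq (σ.nonempty_of_mem_parts hS) τ).1 fun P b hb => ⟨c, hcτ, P.le hb⟩
  · intro hres
    refine ⟨by rintro _ ⟨i, rfl⟩; exact h i, fun τ hτ S hS => ?_⟩
    have htop := hres S hS (τ.restrict (σ.le hS)) fun i =>
      restrict_mono (hτ (Set.mem_range_self i)) _
    rw [isTop_iff_parts_eq (σ.nonempty_of_mem_parts hS)] at htop
    have hmem : S ∈ (τ.restrict (σ.le hS)).parts := by simp [htop]
    simp only [restrict, mem_erase, mem_image] at hmem
    obtain ⟨-, q, hq, hqS⟩ := hmem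
    exact ⟨q, hq, inf_eq_right.1 hqS⟩

lemma sum_isLUB_eq_prod {ι 𝕜 : Type*} [Fintype ι] [DecidableEq ι] [CommSemiring 𝕜] (σ : Finpartition s)
    (w : ι → Finset α → 𝕜) :
    ∑ π : ι → Finpartition s with IsLUB (Set.range π) σ, ∏ i, ∏ p ∈ (π i).parts, w i p =
      ∏ S : σ.parts, ∑ ρ : ι → Finpartition S.1 with JoinIsTop ρ,
        ∏ i, ∏ p ∈ (ρ i).parts, w i p := by
  rw [prod_univ_sum]
  have hle {π : ι → Finpartition s} (h : IsLUB (Set.range π) σ) (i : ι) : π i ≤ σ :=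
    h.1 (Set.mem_range_self i)
  refine sum_bij' (fun π _ S i => (π i).restrict (σ.le S.2))
    (fun ρ _ i => σ.bind fun S hS => ρ ⟨S, hS⟩ i) ?_ ?_ ?_ ?_ ?_
  · intro π hπ
    rw [mem_filter_univ] at hπ
    rw [Fintype.mem_piFinset]
    rintro ⟨S, hS⟩
    rw [mem_filter_univ]
    exact (isLUB_iff_joinIsTop_restrict (hle hπ)).1 hπ S hS
  · intro ρ hρ
    rw [Fintype.mem_piFinset] at hρ
    rw [mem_filter_univ, isLUB_iff_joinIsTop_restrict fun i => bind_le _ _]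
    intro S hS
    have hSρ : (fun i => (σ.bind fun T hT => ρ ⟨T, hT⟩ i).restrict (σ.le hS)) = ρ ⟨S, hS⟩ :=
      funext fun i => restrict_bind σ (fun T hT => ρ ⟨T, hT⟩ i) hS
    rw [hSρ]
    exact (mem_filter_univ _).1 (hρ ⟨S, hS⟩)
  · intro π hπ
    rw [mem_filter_univ] at hπ
    funext i
    exact bind_restrict (hle hπ i)
  · intro ρ _
    funext S i
    exact restrict_bind σ _ S.2
  · intro π hπ
    rw [mem_filter_univ] at hπ
    rw [prod_comm]
    refine prod_congr rfl fun i _ => ?_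
    conv_lhs => rw [← bind_restrict (hle hπ i)]
    exact prod_bind _ _ _

lemma sum_eq_sum_sum_isLUB {ι 𝕜 : Type*} [Fintype ι] [DecidableEq ι] [AddCommMonoid 𝕜]
    (F : (ι → Finpartition s) → 𝕜) :
    ∑ π, F π = ∑ σ : Finpartition s, ∑ π with IsLUB (Set.range π) σ, F π := by
  choose J hJ using fun π : ι → Finpartition s => exists_isLUB (Set.range π)
  rw [← sum_fiberwise univ J F]
  refine sum_congr rfl fun σ _ => sum_congr (filter_congr fun π _ => ?_) fun _ _ => rfl
  exact ⟨fun h => h ▸ hJ π, fun h => (hJ π).unique h⟩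

end Lattice

section Map

variable {α β : Type*} [DecidableEq α] [DecidableEq β] {s : Finset α}

/-- The image of a partition under an embedding. -/
def mapEmbedding (f : α ↪ β) (P : Finpartition s) : Finpartition (s.map f) where
  parts := P.parts.map (Finset.mapEmbedding f).toEmbedding
  supIndep := by
    rw [supIndep_iff_pairwiseDisjoint]
    simp only [coe_map]
    rintro _ ⟨p, hp, rfl⟩ _ ⟨q, hq, rfl⟩ hne
    exact (disjoint_map f).2 (P.disjoint hp hq fun h => hne (h ▸ rfl))
  sup_parts := by
    ext x
    have hmem (a : α) : a ∈ s ↔ ∃ p ∈ P.parts, a ∈ p := by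
      conv_lhs => rw [← P.biUnion_parts]
      simp
    simp only [mem_sup, mem_map, hmem, exists_exists_and_eq_and, RelEmbedding.coe_toEmbedding,
      mapEmbedding_apply, id_eq]
    grind
  bot_notMem := by
    simp

lemma mapEmbedding_surjective (f : α ↪ β) :
    Function.Surjective (mapEmbedding f : Finpartition s → Finpartition (s.map f)) := by
  intro Q
  have key {q : Finset β} (hq : q ∈ Q.parts) : (q.preimage f f.injective.injOn).map f = q := by
    rw [map_eq_image, image_preimage, filter_true_of_mem]
    intro x hx
    obtain ⟨a, -, rfl⟩ := mem_map.1 (Q.le hq hx)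
    exact Set.mem_range_self a
  refine ⟨ofExistsUnique (Q.parts.image fun q => q.preimage f f.injective.injOn) ?_ ?_ ?_, ?_⟩
  · intro p hp
    obtain ⟨q, hq, rfl⟩ := mem_image.1 hp
    rw [← map_subset_map (f := f), key hq]
    exact Q.le hq
  · intro a ha
    obtain ⟨q, ⟨hq, haq⟩, huniq⟩ := Q.existsUnique_mem (mem_map_of_mem f ha)
    refine ⟨q.preimage f f.injective.injOn, ⟨mem_image_of_mem _ hq, by simpa using haq⟩, ?_⟩
    rintro t ⟨ht, hat⟩
    obtain ⟨q', hq', rfl⟩ := mem_image.1 ht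
    rw [huniq q' ⟨hq', by simpa using hat⟩]
  · intro h
    obtain ⟨q, hq, hq0⟩ := mem_image.1 h
    apply Q.ne_bot hq
    rw [← key hq, hq0]
    rfl
  · ext b
    simp only [mapEmbedding, ofExistsUnique_parts, mem_map, mem_image]
    constructor
    · rintro ⟨_, ⟨q, hq, rfl⟩, rfl⟩
      exact (congrArg (· ∈ Q.parts) (key hq)).mpr hq
    · intro hb
      exact ⟨_, ⟨b, hb, rfl⟩, key hb⟩

lemma mapEmbedding_le_mapEmbedding (f : α ↪ β) {P Q : Finpartition s} :
    mapEmbedding f P ≤ mapEmbedding f Q ↔ P ≤ Q := by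
  constructor
  · intro h p hp
    obtain ⟨c, hc, hpc⟩ := h (mem_map_of_mem (Finset.mapEmbedding f).toEmbedding hp)
    obtain ⟨q, hq, rfl⟩ := mem_map.1 hc
    exact ⟨q, hq, map_subset_map.1 hpc⟩
  · intro h b hb
    obtain ⟨p, hp, rfl⟩ := mem_map.1 hb
    obtain ⟨q, hq, hpq⟩ := h hp
    exact ⟨_, mem_map_of_mem _ hq, map_subset_map.2 hpq⟩

/-- Partitions of a finset correspond to partitions of its image under an embedding. -/
noncomputable def mapOrderIso (f : α ↪ β) : Finpartition s ≃o Finpartition (s.map f) :=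
  RelIso.ofSurjective
    (OrderEmbedding.ofMapLEIff (mapEmbedding f) fun _ _ => mapEmbedding_le_mapEmbedding f)
    (mapEmbedding_surjective f)

lemma mapOrderIso_parts (f : α ↪ β) (P : Finpartition s) :
    (mapOrderIso f P).parts = P.parts.map (Finset.mapEmbedding f).toEmbedding :=
  rfl

lemma joinIsTop_mapOrderIso_comp {ι : Type*} (f : α ↪ β) (π : ι → Finpartition s) :
    JoinIsTop (fun i => mapOrderIso f (π i)) ↔ JoinIsTop π := by
  simp only [JoinIsTop, (mapOrderIso f).surjective.forall, OrderIso.le_iff_le, IsTop]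

lemma sum_joinIsTop_map {ι 𝕜 : Type*} [Fintype ι] [DecidableEq ι] [CommSemiring 𝕜] (f : α ↪ β)
    (R : ι → ℕ → 𝕜) :
    ∑ π : ι → Finpartition (s.map f) with JoinIsTop π, ∏ i, ∏ p ∈ (π i).parts, R i p.card =
      ∑ π : ι → Finpartition s with JoinIsTop π, ∏ i, ∏ p ∈ (π i).parts, R i p.card := by
  symm
  refine sum_equiv (Equiv.piCongrRight fun _ => (mapOrderIso f).toEquiv) ?_ ?_
  · intro π
    simp only [mem_filter_univ]
    exact (joinIsTop_mapOrderIso_comp f π).symm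
  · intro π _
    refine prod_congr rfl fun i _ => ?_
    change _ = ∏ p ∈ (mapOrderIso f (π i)).parts, R i p.card
    simp [mapOrderIso_parts]

end Map

end Finpartition

lemma partitionJoinEqOne_iff {n : ℕ} (hn : 1 ≤ n) {ι : Type*}
    (π : ι → Finpartition (univ : Finset (Fin n))) :
    PartitionJoinEqOne π ↔ Finpartition.JoinIsTop π := by
  have : NeZero n := ⟨by omega⟩
  simp only [PartitionJoinEqOne, Finpartition.JoinIsTop,
    Finpartition.isTop_iff_parts_eq univ_nonempty]

/-- **Classical cumulants of a product.**  If, for each `i`, `(R i m)_{m ≥ 1}` is the classical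
cumulant sequence of the moments `(M i n)_{n ≥ 1}` (i.e. `M i n = ∑_{π ∈ P(n)} ∏_{p ∈ π} R i |p|`,
summing over all set partitions), then the classical cumulant sequence of the product moment
sequence `(∏ i, M i n)_{n ≥ 1}` is `Q m = ∑_{π₁ ∨ ⋯ ∨ π_k = 1_m} ∏ i, R i (π i)`. -/
theorem classicalCumulants_of_product (k : ℕ) (hk : 1 ≤ k) (R : Fin k → ℕ → ℝ)
    (M : Fin k → ℕ → ℝ)
    (hM : ∀ i : Fin k, ∀ n : ℕ, 1 ≤ n →
      M i n = ∑ π : Finpartition (univ : Finset (Fin n)), ∏ p ∈ π.parts, R i p.card)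
    (Q : ℕ → ℝ)
    (hQ : ∀ m : ℕ, 1 ≤ m →
      Q m = ∑ π ∈ (univ : Finset (Fin k → Finpartition (univ : Finset (Fin m)))).filter
          PartitionJoinEqOne,
        ∏ i, ∏ p ∈ (π i).parts, R i p.card)
    (n : ℕ) (hn : 1 ≤ n) :
    (∏ i, M i n) = ∑ π : Finpartition (univ : Finset (Fin n)), ∏ p ∈ π.parts, Q p.card := by
  have hQ' {S : Finset (Fin n)} (hS : S.Nonempty) :
      Q S.card = ∑ ρ : Fin k → Finpartition S with Finpartition.JoinIsTop ρ,
        ∏ i, ∏ p ∈ (ρ i).parts, R i p.card := by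
    obtain ⟨m, f, rfl⟩ : ∃ (m : ℕ) (f : Fin m ↪ Fin n), univ.map f = S :=
      ⟨S.card, (S.orderEmbOfFin rfl).toEmbedding, by simp⟩
    have hm : 1 ≤ m := Nat.one_le_iff_ne_zero.2 (by simpa using hS.card_pos.ne')
    rw [Finpartition.sum_joinIsTop_map, card_map, card_fin, hQ m hm]
    simp only [partitionJoinEqOne_iff hm]
  simp only [hM _ n hn]
  rw [prod_univ_sum, Fintype.piFinset_univ, Finpartition.sum_eq_sum_sum_isLUB]
  refine sum_congr rfl fun σ _ => ?_
  rw [Finpartition.sum_isLUB_eq_prod σ fun i p => R i p.card]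
  rw [← prod_coe_sort σ.parts fun p => Q p.card]
  exact prod_congr rfl fun S _ => (hQ' (σ.nonempty_of_mem_parts S.2)).symm
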